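/- arXiv:2509.21909 — 2 statements merged into one kernel-verified Lean document; each statement's English description precedes it below -/
import Mathlib

section
/- Let a, M₁ ∈ ℝ³ and 0 < s < t. Then (a·∇G(t−s)) * (M₁·∇(G(s)²)) = (√(2π)/(32π²)) s^{−3/2} (M₁·∇)(a·∇)G(t − s/2), as functions of x ∈ ℝ³, where G(s)² denotes the pointwise square of the heat kernel at time s and (M₁·∇)(a·∇)G denotes the second directional derivative of G in directions M₁ and a. -/
open MeasureTheory Real Filter
open scoped ENNReal NNReal

/-- The `n`-dimensional Gaussian heat kernel `G(t,x) = (4πt)^{-n/2} exp(-|x|²/(4t))`. -/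
noncomputable def heatG (n : ℕ) (t : ℝ) (x : EuclideanSpace ℝ (Fin n)) : ℝ :=
  (4 * π * t) ^ (-(n : ℝ) / 2) * Real.exp (-‖x‖ ^ 2 / (4 * t))

/-- Directional derivative `a·∇f`. -/
noncomputable def dirD {n : ℕ} (a : EuclideanSpace ℝ (Fin n))
    (f : EuclideanSpace ℝ (Fin n) → ℝ) (x : EuclideanSpace ℝ (Fin n)) : ℝ :=
  fderiv ℝ f x a

/-- Partial derivative `∂_j f`. -/
noncomputable def pd {n : ℕ} (j : Fin n) (f : EuclideanSpace ℝ (Fin n) → ℝ)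
    (x : EuclideanSpace ℝ (Fin n)) : ℝ :=
  fderiv ℝ f x (EuclideanSpace.single j 1)

/-- Spatial Laplacian `Δf = Σ_j ∂_j² f`. -/
noncomputable def lap {n : ℕ} (f : EuclideanSpace ℝ (Fin n) → ℝ)
    (x : EuclideanSpace ℝ (Fin n)) : ℝ :=
  ∑ j : Fin n, pd j (fun z => pd j f z) x

/-- Multi-index spatial derivative `∇^α f = ∂_1^{α_1} ⋯ ∂_n^{α_n} f`. -/
noncomputable def mD {n : ℕ} (α : Fin n → ℕ) (f : EuclideanSpace ℝ (Fin n) → ℝ) :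
    EuclideanSpace ℝ (Fin n) → ℝ :=
  (List.finRange n).foldr (fun j g => (pd j)^[α j] g) f

/-- Iterated time derivative `∂_t^l F`. -/
noncomputable def tD {n : ℕ} (l : ℕ) (F : ℝ → EuclideanSpace ℝ (Fin n) → ℝ) :
    ℝ → EuclideanSpace ℝ (Fin n) → ℝ :=
  (fun H => fun t x => deriv (fun τ => H τ x) t)^[l] F

/-- `u` is a mild solution of `∂_t u - Δu = a·∇(u²)` with initial data `u₀`:
the Duhamel formula `u(t) = G(t)*u₀ + ∫₀ᵗ a·∇G(t-s) * u(s)² ds` holds. -/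
def IsMildSolution {n : ℕ} (a : EuclideanSpace ℝ (Fin n))
    (u₀ : EuclideanSpace ℝ (Fin n) → ℝ) (u : ℝ → EuclideanSpace ℝ (Fin n) → ℝ) : Prop :=
  ∀ t : ℝ, 0 < t → ∀ x, u t x = (∫ y, heatG n t (x - y) * u₀ y) +
    ∫ s in Set.Ioo (0:ℝ) t, ∫ y, dirD a (heatG n (t - s)) (x - y) * (u s y) ^ 2

/-- The decay exponent `γ_q = (n/2)(1 - 1/q)` (with `1/∞ = 0`). -/
noncomputable def gam (n : ℕ) (q : ℝ≥0∞) : ℝ := (n : ℝ) / 2 * (1 - 1 / q.toReal)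

/-- The decay estimate `‖u(t)‖_{L^q} ≤ C(1+t)^{-γ_q}` for all `1 ≤ q ≤ ∞` and `t > 0`. -/
def SatisfiesDecay {n : ℕ} (u : ℝ → EuclideanSpace ℝ (Fin n) → ℝ) : Prop :=
  ∀ q : ℝ≥0∞, 1 ≤ q → ∃ C : ℝ, 0 < C ∧ ∀ t : ℝ, 0 < t →
    eLpNorm (u t) q volume ≤ ENNReal.ofReal (C * (1 + t) ^ (-(gam n q)))

section GaussianMoments

variable {V : Type*} [NormedAddCommGroup V] [InnerProductSpace ℝ V]

lemma hasFDerivAt_rexp_neg_mul_sq_norm (b : ℝ) (z : V) :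
    HasFDerivAt (fun z : V => Real.exp (-b * ‖z‖ ^ 2))
      (Real.exp (-b * ‖z‖ ^ 2) • (-b) • 2 • innerSL ℝ z) z :=
  ((hasStrictFDerivAt_norm_sq z).hasFDerivAt.const_mul (-b)).exp

lemma fderiv_rexp_neg_mul_sq_norm_apply (b : ℝ) (z v : V) :
    fderiv ℝ (fun z : V => Real.exp (-b * ‖z‖ ^ 2)) z v =
      -(2 * b) * (inner ℝ v z * Real.exp (-b * ‖z‖ ^ 2)) := by
  rw [(hasFDerivAt_rexp_neg_mul_sq_norm b z).fderiv]
  simp [real_inner_comm]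
  ring

variable [FiniteDimensional ℝ V] [MeasurableSpace V] [BorelSpace V]

lemma integrable_rexp_neg_mul_sq_norm {b : ℝ} (hb : 0 < b) :
    Integrable (fun z : V => Real.exp (-b * ‖z‖ ^ 2)) := by
  have h := (GaussianFourier.integrable_cexp_neg_mul_sq_norm_add (V := V) (b := b)
    (by simpa using hb) 0 0).norm
  refine h.congr (ae_of_all _ fun z => ?_)
  simp only [Complex.norm_exp]
  congr 1
  simp [← Complex.ofReal_pow, ← Complex.ofReal_mul, ← Complex.ofReal_neg]

lemma integrable_of_norm_le_sq_mul_rexp {b C : ℝ} (hb : 0 < b) {p : V → ℝ} (hp : Continuous p)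
    (hC : ∀ z, |p z| ≤ C * (1 + ‖z‖ ^ 2)) :
    Integrable (fun z : V => p z * Real.exp (-b * ‖z‖ ^ 2)) := by
  have hC0 : 0 ≤ C := by simpa using (abs_nonneg _).trans (hC 0)
  refine ((integrable_rexp_neg_mul_sq_norm (V := V) (half_pos hb)).const_mul
    (C * (1 + 2 / b))).mono' (by fun_prop) (ae_of_all _ fun z => ?_)
  have hexp : Real.exp (-b * ‖z‖ ^ 2) =
      Real.exp (-(b / 2) * ‖z‖ ^ 2) * Real.exp (-(b / 2) * ‖z‖ ^ 2) := by
    rw [← Real.exp_add]; congr 1; ring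
  have hpoly : (1 + ‖z‖ ^ 2) * Real.exp (-(b / 2) * ‖z‖ ^ 2) ≤ 1 + 2 / b := by
    rw [neg_mul, Real.exp_neg, ← div_eq_mul_inv, div_le_iff₀ (Real.exp_pos _)]
    calc 1 + ‖z‖ ^ 2 ≤ (1 + 2 / b) * (b / 2 * ‖z‖ ^ 2 + 1) := by
          have : (1 + 2 / b) * (b / 2 * ‖z‖ ^ 2 + 1) =
            1 + ‖z‖ ^ 2 + (b / 2 * ‖z‖ ^ 2 + 2 / b) := by field_simp; ring
          rw [this]
          have : 0 ≤ b / 2 * ‖z‖ ^ 2 + 2 / b := by positivity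
          linarith
      _ ≤ _ := by gcongr; exact Real.add_one_le_exp _
  rw [norm_mul, Real.norm_eq_abs, Real.norm_eq_abs, Real.abs_exp]
  calc |p z| * Real.exp (-b * ‖z‖ ^ 2)
      ≤ C * (1 + ‖z‖ ^ 2) * Real.exp (-b * ‖z‖ ^ 2) := by gcongr; exact hC z
    _ = C * ((1 + ‖z‖ ^ 2) * Real.exp (-(b / 2) * ‖z‖ ^ 2)) *
          Real.exp (-(b / 2) * ‖z‖ ^ 2) := by rw [hexp]; ring
    _ ≤ _ := by gcongr

lemma integrable_inner_mul_rexp {b : ℝ} (hb : 0 < b) (v : V) :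
    Integrable (fun z : V => inner ℝ v z * Real.exp (-b * ‖z‖ ^ 2)) := by
  refine integrable_of_norm_le_sq_mul_rexp hb (C := ‖v‖) (by fun_prop) fun z => ?_
  refine (abs_real_inner_le_norm v z).trans ?_
  gcongr
  nlinarith [sq_nonneg (‖z‖ - 1), norm_nonneg z]

lemma integrable_inner_mul_inner_mul_rexp {b : ℝ} (hb : 0 < b) (v w : V) :
    Integrable (fun z : V => inner ℝ v z * inner ℝ w z * Real.exp (-b * ‖z‖ ^ 2)) := by
  refine integrable_of_norm_le_sq_mul_rexp hb (C := ‖v‖ * ‖w‖) (by fun_prop) fun z => ?_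
  rw [abs_mul]
  calc |inner ℝ v z| * |inner ℝ w z| ≤ (‖v‖ * ‖z‖) * (‖w‖ * ‖z‖) := by
        gcongr <;> exact abs_real_inner_le_norm _ _
    _ = ‖v‖ * ‖w‖ * ‖z‖ ^ 2 := by ring
    _ ≤ _ := by gcongr; linarith

lemma integral_inner_mul_rexp (b : ℝ) (v : V) :
    ∫ z : V, inner ℝ v z * Real.exp (-b * ‖z‖ ^ 2) = 0 := by
  have h := integral_neg_eq_self (fun z : V => inner ℝ v z * Real.exp (-b * ‖z‖ ^ 2)) volume
  simp only [inner_neg_right, norm_neg, neg_mul, integral_neg] at h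
  simp only [neg_mul]
  linarith

lemma integral_inner_mul_inner_mul_rexp {b : ℝ} (hb : 0 < b) (v w : V) :
    ∫ z : V, inner ℝ v z * inner ℝ w z * Real.exp (-b * ‖z‖ ^ 2) =
      inner ℝ v w / (2 * b) * ∫ z : V, Real.exp (-b * ‖z‖ ^ 2) := by
  have hv (z : V) : fderiv ℝ (fun z : V => inner ℝ v z) z w = inner ℝ v w := by
    rw [show (fun z : V => inner ℝ v z) = innerSL ℝ v from rfl, ContinuousLinearMap.fderiv]
    rfl
  have h := integral_mul_fderiv_eq_neg_fderiv_mul_of_integrable (𝕜 := ℝ) (μ := volume)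
    (f := fun z : V => inner ℝ v z) (g := fun z : V => Real.exp (-b * ‖z‖ ^ 2)) (v := w)
    (by simpa only [hv] using (integrable_rexp_neg_mul_sq_norm hb).const_mul _)
    (by
      simp only [fderiv_rexp_neg_mul_sq_norm_apply]
      refine ((integrable_inner_mul_inner_mul_rexp hb v w).const_mul (-(2 * b))).congr
        (ae_of_all _ fun z => ?_)
      ring)
    (integrable_inner_mul_rexp hb v) (fun z _ => (innerSL ℝ v).differentiableAt)
    (fun z _ => (hasFDerivAt_rexp_neg_mul_sq_norm b z).differentiableAt)
  simp only [hv, fderiv_rexp_neg_mul_sq_norm_apply, integral_const_mul] at h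
  have h' : ∀ z : V, inner ℝ v z * (-(2 * b) * (inner ℝ w z * Real.exp (-b * ‖z‖ ^ 2))) =
      -(2 * b) * (inner ℝ v z * inner ℝ w z * Real.exp (-b * ‖z‖ ^ 2)) := fun z => by ring
  simp only [h', integral_const_mul] at h
  field_simp
  simp only [neg_mul] at h ⊢
  linarith

/-- Integral of a product of two affine functions against a centred Gaussian. -/
lemma integral_affine_mul_affine_mul_rexp {b : ℝ} (hb : 0 < b) (v w : V) (α β : ℝ) :
    ∫ z : V, (α - inner ℝ v z) * (inner ℝ w z + β) * Real.exp (-b * ‖z‖ ^ 2) =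
      (α * β - inner ℝ v w / (2 * b)) * ∫ z : V, Real.exp (-b * ‖z‖ ^ 2) := by
  have h0 := (integrable_rexp_neg_mul_sq_norm (V := V) hb).const_mul (α * β)
  have hv := (integrable_inner_mul_rexp hb v).const_mul β
  have hw := (integrable_inner_mul_rexp hb w).const_mul α
  have hvw := integrable_inner_mul_inner_mul_rexp hb v w
  calc _ = ∫ z : V, (α * β * Real.exp (-b * ‖z‖ ^ 2) +
        α * (inner ℝ w z * Real.exp (-b * ‖z‖ ^ 2))) -
        (β * (inner ℝ v z * Real.exp (-b * ‖z‖ ^ 2)) +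
          inner ℝ v z * inner ℝ w z * Real.exp (-b * ‖z‖ ^ 2)) := by
        congr 1; ext z; ring
    _ = _ := by
        refine (integral_sub (h0.add hw) (hv.add hvw)).trans ?_
        rw [integral_add' h0 hw, integral_add' hv hvw,
          integral_const_mul, integral_const_mul, integral_const_mul,
          integral_inner_mul_rexp, integral_inner_mul_rexp,
          integral_inner_mul_inner_mul_rexp hb]
        ring

end GaussianMoments

lemma heatG_eq (n : ℕ) (t : ℝ) :
    heatG n t = fun x => (4 * π * t) ^ (-(n : ℝ) / 2) * Real.exp (-(1 / (4 * t)) * ‖x‖ ^ 2) := by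
  ext x
  rw [heatG]
  congr 2
  ring

lemma dirD_const_mul_rexp {n : ℕ} (v : EuclideanSpace ℝ (Fin n)) (c b : ℝ) :
    dirD v (fun x => c * Real.exp (-b * ‖x‖ ^ 2)) =
      fun x => -(2 * b) * c * (inner ℝ v x * Real.exp (-b * ‖x‖ ^ 2)) := by
  ext x
  rw [dirD, fderiv_const_mul (hasFDerivAt_rexp_neg_mul_sq_norm b x).differentiableAt]
  rw [smul_apply, fderiv_rexp_neg_mul_sq_norm_apply, smul_eq_mul]
  ring

lemma dirD_dirD_const_mul_rexp {n : ℕ} (v w : EuclideanSpace ℝ (Fin n)) (c b : ℝ)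
    (x : EuclideanSpace ℝ (Fin n)) :
    dirD w (dirD v (fun x => c * Real.exp (-b * ‖x‖ ^ 2))) x =
      (4 * b ^ 2 * inner ℝ v x * inner ℝ w x - 2 * b * inner ℝ v w) *
        (c * Real.exp (-b * ‖x‖ ^ 2)) := by
  have hv : HasFDerivAt (fun x : EuclideanSpace ℝ (Fin n) => (inner ℝ v x : ℝ))
      (innerSL ℝ v) x := (innerSL ℝ v).hasFDerivAt
  have h : HasFDerivAt (fun x => -(2 * b) * c * (inner ℝ v x * Real.exp (-b * ‖x‖ ^ 2))) _ x :=
    (hv.mul (hasFDerivAt_rexp_neg_mul_sq_norm b x)).const_mul (-(2 * b) * c)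
  rw [dirD_const_mul_rexp, dirD, h.fderiv]
  simp [real_inner_comm]
  ring

lemma heat_normalization {s τ : ℝ} (hs : 0 < s) (hτ : 0 < τ) :
    (4 * π * τ) ^ (-(3 : ℝ) / 2) * ((4 * π * s) ^ (-(3 : ℝ) / 2)) ^ 2 *
        (π / ((τ + s / 2) / (2 * τ * s))) ^ ((3 : ℝ) / 2) =
      Real.sqrt (2 * π) / (32 * π ^ 2) * s ^ (-(3 : ℝ) / 2) *
        (4 * π * (τ + s / 2)) ^ (-(3 : ℝ) / 2) := by
  have hneg {u : ℝ} (hu : 0 < u) : (u ^ (-(3 : ℝ) / 2)) ^ 2 = (u ^ 3)⁻¹ := by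
    rw [← Real.rpow_natCast, ← Real.rpow_mul hu.le, ← Real.rpow_natCast, ← Real.rpow_neg hu.le]
    norm_num
  have hpos {u : ℝ} (hu : 0 < u) : (u ^ ((3 : ℝ) / 2)) ^ 2 = u ^ 3 := by
    rw [← Real.rpow_natCast, ← Real.rpow_mul hu.le, ← Real.rpow_natCast]
    norm_num
  have hπ := Real.pi_pos
  refine (sq_eq_sq₀ (by positivity) (by positivity)).1 ?_
  simp only [mul_pow _ _ 2, div_pow _ _ 2]
  rw [hneg (by positivity), hneg (by positivity), hpos (by positivity), hneg hs,
    hneg (by positivity), Real.sq_sqrt (by positivity)]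
  field_simp
  ring

/-- convolution identity
`(a·∇G(t−s)) * (M₁·∇(G(s)²)) = (√(2π)/(32π²)) s^{−3/2} (M₁·∇)(a·∇)G(t − s/2)` on ℝ³. -/
theorem conv_identity_dir (a M₁ : EuclideanSpace ℝ (Fin 3)) (s t : ℝ) (hs : 0 < s)
    (hst : s < t) :
    ∀ x : EuclideanSpace ℝ (Fin 3),
      (∫ y, dirD a (heatG 3 (t - s)) (x - y) * dirD M₁ (fun z => (heatG 3 s z) ^ 2) y) =
        Real.sqrt (2 * π) / (32 * π ^ 2) * s ^ (-(3 : ℝ) / 2) *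
          dirD M₁ (dirD a (heatG 3 (t - s / 2))) x := by
  intro x
  obtain ⟨τ, hτ, rfl⟩ : ∃ τ, 0 < τ ∧ t = τ + s := ⟨t - s, by linarith, by ring⟩
  have hsq : (fun z => heatG 3 s z ^ 2) = fun z =>
      ((4 * π * s) ^ (-(3 : ℝ) / 2)) ^ 2 * Real.exp (-(1 / (2 * s)) * ‖z‖ ^ 2) := by
    ext z
    rw [heatG_eq, mul_pow, ← Real.exp_nat_mul]
    push_cast
    congr 2
    field_simp
    ring
  rw [show τ + s - s = τ by ring, show τ + s - s / 2 = τ + s / 2 by ring, hsq, heatG_eq, heatG_eq,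
    dirD_dirD_const_mul_rexp, dirD_const_mul_rexp, dirD_const_mul_rexp]
  push_cast
  set T := τ + s / 2 with hT
  have hT0 : 0 < T := by positivity
  set b := T / (2 * τ * s) with hb
  have hb0 : 0 < b := by positivity
  have hsquare (z : EuclideanSpace ℝ (Fin 3)) :
      Real.exp (-(1 / (4 * τ)) * ‖x - (z + (s / (2 * T)) • x)‖ ^ 2) *
        Real.exp (-(1 / (2 * s)) * ‖z + (s / (2 * T)) • x‖ ^ 2) =
      Real.exp (-(1 / (4 * T)) * ‖x‖ ^ 2) * Real.exp (-b * ‖z‖ ^ 2) := by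
    rw [← Real.exp_add, ← Real.exp_add]
    congr 1
    rw [norm_sub_sq_real, norm_add_sq_real, inner_add_right, real_inner_smul_right,
      real_inner_smul_right, norm_smul, real_inner_self_eq_norm_sq, mul_pow, Real.norm_eq_abs,
      sq_abs, real_inner_comm x z, hb, hT]
    field_simp
    ring
  rw [← integral_add_right_eq_self _ ((s / (2 * T)) • x)]
  calc _ = ∫ z, (1 / (2 * τ * s) * (4 * π * τ) ^ (-(3 : ℝ) / 2) *
          ((4 * π * s) ^ (-(3 : ℝ) / 2)) ^ 2 * Real.exp (-(1 / (4 * T)) * ‖x‖ ^ 2)) *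
        ((τ / T * inner ℝ a x - inner ℝ a z) * (inner ℝ M₁ z + s / (2 * T) * inner ℝ M₁ x) *
          Real.exp (-b * ‖z‖ ^ 2)) := by
        congr 1
        ext z
        have hx : inner ℝ a (x - (z + (s / (2 * T)) • x)) =
            τ / T * inner ℝ a x - inner ℝ a z := by
          rw [inner_sub_right, inner_add_right, real_inner_smul_right, hT]
          field_simp
          ring
        have hy : inner ℝ M₁ (z + (s / (2 * T)) • x) =
            inner ℝ M₁ z + s / (2 * T) * inner ℝ M₁ x := by
          rw [inner_add_right, real_inner_smul_right]
        rw [hx, hy]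
        linear_combination (1 / (2 * τ * s) * (4 * π * τ) ^ (-(3 : ℝ) / 2) *
          ((4 * π * s) ^ (-(3 : ℝ) / 2)) ^ 2 * (τ / T * inner ℝ a x - inner ℝ a z) *
          (inner ℝ M₁ z + s / (2 * T) * inner ℝ M₁ x)) * hsquare z
    _ = (1 / (2 * τ * s) * (τ / T * inner ℝ a x * (s / (2 * T) * inner ℝ M₁ x) -
          inner ℝ a M₁ / (2 * b))) * Real.exp (-(1 / (4 * T)) * ‖x‖ ^ 2) *
          ((4 * π * τ) ^ (-(3 : ℝ) / 2) * ((4 * π * s) ^ (-(3 : ℝ) / 2)) ^ 2 *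
            (π / b) ^ ((3 : ℝ) / 2)) := by
        rw [integral_const_mul, integral_affine_mul_affine_mul_rexp hb0,
          GaussianFourier.integral_rexp_neg_mul_sq_norm hb0, finrank_euclideanSpace_fin]
        push_cast
        ring
    _ = _ := by
        rw [hb, hT, heat_normalization hs hτ, ← hT]
        field_simp
        ring
end

section
/- Let G(t,x) = (4πt)^{−3/2} exp(−|x|²/(4t)) be the three-dimensional Gaussian heat kernel. Then for each j ∈ {1,2,3} and each k ≠ j: (i) ∫_{ℝ³} y_j G(1,y) ( ∫₀¹ s^{−1/2} Δ∂_j G(1 − s/2, y) ds ) dy = 7√(6π)/(2³·3³ π²); (ii) ∫_{ℝ³} y_k² y_j G(1,y) ( ∫₀¹ s^{−1/2} Δ∂_j G(1 − s/2, y) ds ) dy = 11√(6π)/(2·3⁴·5 π²); (iii) ∫_{ℝ³} y_j³ G(1,y) ( ∫₀¹ s^{−1/2} Δ∂_j G(1 − s/2, y) ds ) dy = 11√(6π)/(2·3³·5 π²). -/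
open MeasureTheory Real Filter
open scoped ENNReal NNReal

lemma hasFDerivAt_heatG {n : ℕ} (t : ℝ) (x : EuclideanSpace ℝ (Fin n)) :
    HasFDerivAt (heatG n t) ((-(heatG n t x) / (2 * t)) • innerSL ℝ x) x := by
  have h := (((hasStrictFDerivAt_norm_sq x).hasFDerivAt.neg.mul_const (4 * t)⁻¹).exp).const_mul
    ((4 * π * t) ^ (-(n : ℝ) / 2))
  refine HasFDerivAt.congr_fderiv (f := heatG n t) h ?_
  ext v
  simp only [heatG, div_eq_mul_inv, Pi.neg_apply, mul_inv, FunLike.coe_smul, Pi.smul_apply,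
    FunLike.coe_neg, innerSL_apply_apply, smul_eq_mul, two_nsmul, FunLike.coe_add, Pi.add_apply]
  ring

lemma pd_mul_heatG {n : ℕ} (t : ℝ) (k : Fin n) {p : EuclideanSpace ℝ (Fin n) → ℝ}
    {p' : EuclideanSpace ℝ (Fin n) →L[ℝ] ℝ} {x : EuclideanSpace ℝ (Fin n)}
    (hp : HasFDerivAt p p' x) :
    pd k (fun y => p y * heatG n t y) x =
      (p' (EuclideanSpace.single k 1) - p x * x k / (2 * t)) * heatG n t x := by
  rw [pd, (hp.fun_mul (hasFDerivAt_heatG t x)).fderiv]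
  simp [EuclideanSpace.inner_single_right]
  ring

lemma pd_heatG {n : ℕ} (t : ℝ) (j : Fin n) :
    pd j (heatG n t) = fun y => -(y j) / (2 * t) * heatG n t y := by
  ext x
  have := pd_mul_heatG t j (hasFDerivAt_const (1 : ℝ) x)
  simp only [one_mul] at this
  rw [this]
  simp
  ring

lemma hasFDerivAt_coord {n : ℕ} (j : Fin n) (x : EuclideanSpace ℝ (Fin n)) :
    HasFDerivAt (fun y : EuclideanSpace ℝ (Fin n) => y j)
      (EuclideanSpace.proj j : EuclideanSpace ℝ (Fin n) →L[ℝ] ℝ) x :=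
  (EuclideanSpace.proj j : EuclideanSpace ℝ (Fin n) →L[ℝ] ℝ).hasFDerivAt

lemma pd_pd_heatG {n : ℕ} (t : ℝ) (j k : Fin n) :
    pd k (pd j (heatG n t)) = fun y =>
      (-(if j = k then 1 else 0) / (2 * t) + y j * y k / (4 * t ^ 2)) * heatG n t y := by
  ext x
  have h : HasFDerivAt (fun y : EuclideanSpace ℝ (Fin n) => -(y j) / (2 * t)) _ x :=
    (hasFDerivAt_coord j x).neg.mul_const (2 * t)⁻¹
  rw [pd_heatG, pd_mul_heatG t k h]
  by_cases hjk : j = k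
  · subst hjk
    simp only [smul_neg, FunLike.coe_neg, FunLike.coe_smul, Pi.neg_apply, Pi.smul_apply,
      PiLp.proj_apply, PiLp.single_apply, smul_eq_mul, if_true]
    ring
  · simp only [smul_neg, FunLike.coe_neg, FunLike.coe_smul, Pi.neg_apply, Pi.smul_apply,
      PiLp.proj_apply, PiLp.single_apply, smul_eq_mul, hjk, if_false]
    ring

lemma pd_pd_pd_heatG {n : ℕ} (t : ℝ) (j k : Fin n) (x : EuclideanSpace ℝ (Fin n)) :
    pd k (pd k (pd j (heatG n t))) x =
      (x j / (4 * t ^ 2) + 2 * (if j = k then x j else 0) / (4 * t ^ 2)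
        - x j * x k ^ 2 / (8 * t ^ 3)) * heatG n t x := by
  have h : HasFDerivAt (fun y : EuclideanSpace ℝ (Fin n) =>
      -(if j = k then (1 : ℝ) else 0) / (2 * t) + y j * y k / (4 * t ^ 2)) _ x :=
    (((hasFDerivAt_coord j x).mul (hasFDerivAt_coord k x)).mul_const (4 * t ^ 2)⁻¹).const_add _
  rw [pd_pd_heatG, pd_mul_heatG t k h]
  by_cases hjk : j = k
  · subst hjk
    simp only [FunLike.coe_smul, FunLike.coe_add, Pi.add_apply, Pi.smul_apply,
      PiLp.proj_apply, PiLp.single_apply, smul_eq_mul, if_true]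
    ring
  · simp only [FunLike.coe_smul, FunLike.coe_add, Pi.add_apply, Pi.smul_apply,
      PiLp.proj_apply, PiLp.single_apply, smul_eq_mul, hjk, if_true, if_false]
    ring

lemma lap_pd_heatG {n : ℕ} (t : ℝ) (j : Fin n) (x : EuclideanSpace ℝ (Fin n)) :
    lap (pd j (heatG n t)) x =
      x j * ((n + 2) / (4 * t ^ 2) - ‖x‖ ^ 2 / (8 * t ^ 3)) * heatG n t x := by
  rw [lap, EuclideanSpace.real_norm_sq_eq]
  simp only [pd_pd_pd_heatG]
  rw [← Finset.sum_mul, Finset.sum_sub_distrib, Finset.sum_add_distrib, ← Finset.sum_div,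
    ← Finset.sum_div, ← Finset.sum_div, ← Finset.mul_sum, ← Finset.mul_sum, Finset.sum_ite_eq]
  simp only [Finset.sum_const, Finset.card_univ, Fintype.card_fin, nsmul_eq_mul,
    Finset.mem_univ, if_true]
  ring

lemma integral_pow_even_mul_exp_neg_mul_sq {b : ℝ} (hb : 0 < b) (k : ℕ) :
    ∫ x : ℝ, x ^ (2 * k) * rexp (-b * x ^ 2) =
      (2 * k - 1).doubleFactorial / (2 * b) ^ k * √(π / b) := by
  have h1 : ∫ x : ℝ, x ^ (2 * k) * rexp (-b * x ^ 2) =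
      ∫ x : ℝ, (fun z => z ^ (2 * k) * rexp (-b * z ^ 2)) |x| := by
    congr 1 with x
    simp [pow_mul]
  have h2 := integral_rpow_mul_exp_neg_mul_rpow (p := 2) (q := 2 * k) (b := b) two_pos
    (by have : (0 : ℝ) ≤ k := k.cast_nonneg
        linarith) hb
  have h3 : ((2 : ℝ) * k + 1) / 2 = k + 1 / 2 := by ring
  have h4 : -((2 : ℝ) * k + 1) / 2 = -(k + 1 / 2) := by ring
  have h5 (x : ℝ) : x ^ ((2 : ℝ) * k) = x ^ (2 * k) := by exact_mod_cast rpow_natCast x (2 * k)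
  simp only [h5, rpow_two] at h2
  rw [h1, integral_comp_abs (f := fun z => z ^ (2 * k) * rexp (-b * z ^ 2)), h2, h3, h4,
    Real.Gamma_nat_add_half, rpow_neg hb.le, rpow_add hb, rpow_natCast, ← sqrt_eq_rpow, 
    sqrt_div pi_pos.le, mul_pow]
  field_simp

lemma integrable_pow_mul_exp_neg_mul_sq {b : ℝ} (hb : 0 < b) (k : ℕ) :
    Integrable (fun x : ℝ => x ^ k * rexp (-b * x ^ 2)) := by
  have := integrable_rpow_mul_exp_neg_mul_sq hb (s := k)
    (by have : (0 : ℝ) ≤ k := k.cast_nonneg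
        linarith)
  simpa only [rpow_natCast] using this

section Moments

variable {n : ℕ}

lemma prod_pow_mul_exp_neg_mul_norm_sq (b : ℝ) (c : Fin n → ℕ) (y : EuclideanSpace ℝ (Fin n)) :
    (∏ i, y i ^ (2 * c i)) * rexp (-b * ‖y‖ ^ 2) =
      ∏ i, (y i ^ (2 * c i) * rexp (-b * y i ^ 2)) := by
  rw [EuclideanSpace.real_norm_sq_eq, Finset.mul_sum, exp_sum, Finset.prod_mul_distrib]

lemma integrable_prod_pow_mul_exp_neg_mul_norm_sq {b : ℝ} (hb : 0 < b) (c : Fin n → ℕ) :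
    Integrable (fun y : EuclideanSpace ℝ (Fin n) =>
      (∏ i, y i ^ (2 * c i)) * rexp (-b * ‖y‖ ^ 2)) := by
  simp only [prod_pow_mul_exp_neg_mul_norm_sq]
  have e := EuclideanSpace.volume_preserving_symm_measurableEquiv_toLp (Fin n)
  exact e.integrable_comp_of_integrable
    (Integrable.fintype_prod fun i => integrable_pow_mul_exp_neg_mul_sq hb (2 * c i))

lemma integral_prod_pow_mul_exp_neg_mul_norm_sq {b : ℝ} (hb : 0 < b) (c : Fin n → ℕ) :
    ∫ y : EuclideanSpace ℝ (Fin n), (∏ i, y i ^ (2 * c i)) * rexp (-b * ‖y‖ ^ 2) =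
      (∏ i, ((2 * c i - 1).doubleFactorial : ℝ)) / (2 * b) ^ (∑ i, c i) * √(π / b) ^ n := by
  simp only [prod_pow_mul_exp_neg_mul_norm_sq]
  have h := (EuclideanSpace.volume_preserving_symm_measurableEquiv_toLp (Fin n)).integral_comp'
    (fun x : Fin n → ℝ => ∏ i, (x i ^ (2 * c i) * rexp (-b * x i ^ 2)))
  refine h.trans ?_
  rw [integral_fintype_prod_volume_eq_prod (fun i x => x ^ (2 * c i) * rexp (-b * x ^ 2))]
  simp only [integral_pow_even_mul_exp_neg_mul_sq hb]
  rw [Finset.prod_mul_distrib, Finset.prod_div_distrib, Finset.prod_pow_eq_pow_sum,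
    Finset.prod_const, Finset.card_univ, Fintype.card_fin]

lemma prod_pow_mul_norm_sq_mul_exp (b : ℝ) (c : Fin n → ℕ) (y : EuclideanSpace ℝ (Fin n)) :
    (∏ i, y i ^ (2 * c i)) * ‖y‖ ^ 2 * rexp (-b * ‖y‖ ^ 2) =
      ∑ j, (∏ i, y i ^ (2 * (c + Pi.single j 1 : Fin n → ℕ) i)) * rexp (-b * ‖y‖ ^ 2) := by
  rw [← Finset.sum_mul, EuclideanSpace.real_norm_sq_eq, Finset.mul_sum]
  congr 1
  refine Finset.sum_congr rfl fun j _ => ?_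
  simp only [Pi.add_apply, mul_add, pow_add, Finset.prod_mul_distrib]
  congr 1
  rw [Finset.prod_eq_single j] <;> simp +contextual

lemma integrable_prod_pow_mul_norm_sq_mul_exp {b : ℝ} (hb : 0 < b) (c : Fin n → ℕ) :
    Integrable (fun y : EuclideanSpace ℝ (Fin n) =>
      (∏ i, y i ^ (2 * c i)) * ‖y‖ ^ 2 * rexp (-b * ‖y‖ ^ 2)) := by
  simp only [prod_pow_mul_norm_sq_mul_exp]
  exact integrable_finsetSum _ fun j _ => integrable_prod_pow_mul_exp_neg_mul_norm_sq hb _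

lemma integral_prod_pow_mul_norm_sq_mul_exp {b : ℝ} (hb : 0 < b) (c : Fin n → ℕ) :
    ∫ y : EuclideanSpace ℝ (Fin n), (∏ i, y i ^ (2 * c i)) * ‖y‖ ^ 2 * rexp (-b * ‖y‖ ^ 2) =
      (∏ i, ((2 * c i - 1).doubleFactorial : ℝ)) / (2 * b) ^ (∑ i, c i) * √(π / b) ^ n *
        ((2 * (∑ i, c i : ℕ) + n) / (2 * b)) := by
  have hfac (k : ℕ) :
      (2 * (k + 1) - 1).doubleFactorial = (2 * k - 1).doubleFactorial * (2 * k + 1) := by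
    cases k with
    | zero => rfl
    | succ m =>
      have : 2 * (m + 1 + 1) - 1 = (2 * (m + 1) - 1) + 2 := by omega
      rw [this, Nat.doubleFactorial_add_two, mul_comm]
      congr 1
  have hprod (j : Fin n) :
      ∏ i, ((2 * (c + Pi.single j 1 : Fin n → ℕ) i - 1).doubleFactorial : ℝ) =
        (∏ i, ((2 * c i - 1).doubleFactorial : ℝ)) * (2 * c j + 1) := by
    have (i : Fin n) : ((2 * (c + Pi.single j 1 : Fin n → ℕ) i - 1).doubleFactorial : ℝ) =
        ((2 * c i - 1).doubleFactorial : ℝ) * if i = j then (2 * c j + 1 : ℝ) else 1 := by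
      by_cases h : i = j
      · subst h
        simp [hfac]
      · simp [h]
    simp only [this, Finset.prod_mul_distrib]
    simp
  have hsum (j : Fin n) : ∑ i, (c + Pi.single j 1 : Fin n → ℕ) i = ∑ i, c i + 1 := by
    simp [Finset.sum_add_distrib]
  simp only [prod_pow_mul_norm_sq_mul_exp]
  rw [integral_finsetSum _ fun j _ => integrable_prod_pow_mul_exp_neg_mul_norm_sq hb _]
  simp only [integral_prod_pow_mul_exp_neg_mul_norm_sq hb, hprod, hsum]
  have hlin : (2 * (∑ i, c i : ℕ) + n : ℝ) = ∑ j, (2 * (c j : ℝ) + 1) := by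
    simp [Finset.sum_add_distrib, Finset.mul_sum]
  rw [hlin, Finset.sum_div, Finset.mul_sum]
  refine Finset.sum_congr rfl fun j _ => ?_
  rw [pow_succ]
  field_simp

end Moments

lemma hasDerivAt_sqrt_div_sqrt_four_sub {s : ℝ} (hs : s ∈ Set.Ioo (0 : ℝ) 1) :
    HasDerivAt (fun s : ℝ => √s / √(4 - s)) (2 / (√s * √(4 - s) ^ 3)) s := by
  have h0 : 0 < s := hs.1
  have h4 : 0 < 4 - s := by linarith [hs.2]
  have hp := sqrt_pos.2 h0
  have hq := sqrt_pos.2 h4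
  have h := (hasDerivAt_sqrt h0.ne').fun_div (((hasDerivAt_id' s).const_sub 4).sqrt h4.ne') hq.ne'
  refine h.congr_deriv ?_
  have hs2 : √s ^ 2 = s := sq_sqrt h0.le
  have hq2 : √(4 - s) ^ 2 = 4 - s := sq_sqrt h4.le
  field_simp
  rw [hq2, hs2]
  ring

lemma integral_Ioo_of_hasDerivAt_of_nonneg {F f : ℝ → ℝ}
    (hF : ContinuousOn F (Set.Icc 0 1)) (hd : ∀ s ∈ Set.Ioo (0 : ℝ) 1, HasDerivAt F (f s) s)
    (hf : ∀ s ∈ Set.Ioo (0 : ℝ) 1, 0 ≤ f s) :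
    IntegrableOn f (Set.Ioo 0 1) ∧ ∫ s in Set.Ioo (0 : ℝ) 1, f s = F 1 - F 0 := by
  have hi : IntegrableOn f (Set.Ioc 0 1) := intervalIntegral.integrableOn_deriv_of_nonneg hF hd hf
  refine ⟨hi.mono_set Set.Ioo_subset_Ioc_self, ?_⟩
  rw [← integral_Ioc_eq_integral_Ioo, ← intervalIntegral.integral_of_le zero_le_one]
  exact intervalIntegral.integral_eq_sub_of_hasDerivAt_of_le zero_le_one hF hd
    ((intervalIntegrable_iff_integrableOn_Ioc_of_le zero_le_one).2 hi)

lemma continuousOn_sqrt_div_sqrt_four_sub :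
    ContinuousOn (fun s : ℝ => √s / √(4 - s)) (Set.Icc 0 1) := by
  refine ContinuousOn.div (by fun_prop) (by fun_prop) fun s hs => ?_
  exact (sqrt_pos.2 (by linarith [hs.2])).ne'

lemma integral_inv_sqrt_mul_sqrt_four_sub_pow_seven :
    IntegrableOn (fun s : ℝ => 1 / (√s * √(4 - s) ^ 7)) (Set.Ioo 0 1) ∧
      ∫ s in Set.Ioo (0 : ℝ) 1, 1 / (√s * √(4 - s) ^ 7) = 7 / (180 * √3) := by
  have hc := continuousOn_sqrt_div_sqrt_four_sub
  have h := integral_Ioo_of_hasDerivAt_of_nonneg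
    (F := fun s => (2 * (√s / √(4 - s)) + 4 / 3 * (√s / √(4 - s)) ^ 3 +
      2 / 5 * (√s / √(4 - s)) ^ 5) / 64) (f := fun s : ℝ => 1 / (√s * √(4 - s) ^ 7))
    (by fun_prop) (fun s hs => ?_) (fun s _ => by positivity)
  · refine ⟨h.1, h.2.trans ?_⟩
    have h3 : √(4 - 1 : ℝ) = √3 := by norm_num
    have hsq_three : √(3 : ℝ) ^ 2 = 3 := sq_sqrt (by norm_num)
    have hpow_three : √(3 : ℝ) ^ 4 = 9 := by rw [show 4 = 2 * 2 from rfl, pow_mul, hsq_three]; norm_num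
    simp only [h3, sqrt_one, sqrt_zero]
    field_simp
    simp only [hsq_three, hpow_three]
    norm_num
  · have hr := hasDerivAt_sqrt_div_sqrt_four_sub hs
    refine ((((hr.const_mul 2).fun_add ((hr.fun_pow 3).const_mul (4 / 3))).fun_add
      ((hr.fun_pow 5).const_mul (2 / 5))).div_const 64).congr_deriv ?_
    have hp : 0 < √s := sqrt_pos.2 hs.1
    have hq : 0 < √(4 - s) := sqrt_pos.2 (by linarith [hs.2])
    have hpq : √s ^ 2 = 4 - √(4 - s) ^ 2 := by
      rw [sq_sqrt hs.1.le, sq_sqrt (by linarith [hs.2])]; ring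
    push_cast
    field_simp
    have hp4 : √s ^ 4 = (4 - √(4 - s) ^ 2) ^ 2 := by rw [← hpq]; ring
    rw [hp4, hpq]
    ring

lemma integral_inv_sqrt_mul_sqrt_four_sub_pow_nine :
    IntegrableOn (fun s : ℝ => 1 / (√s * √(4 - s) ^ 9)) (Set.Ioo 0 1) ∧
      ∫ s in Set.Ioo (0 : ℝ) 1, 1 / (√s * √(4 - s) ^ 9) = 83 / (7560 * √3) := by
  have hc := continuousOn_sqrt_div_sqrt_four_sub
  have h := integral_Ioo_of_hasDerivAt_of_nonneg
    (F := fun s => (2 * (√s / √(4 - s)) + 2 * (√s / √(4 - s)) ^ 3 +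
      6 / 5 * (√s / √(4 - s)) ^ 5 + 2 / 7 * (√s / √(4 - s)) ^ 7) / 256)
    (f := fun s : ℝ => 1 / (√s * √(4 - s) ^ 9))
    (by fun_prop) (fun s hs => ?_) (fun s _ => by positivity)
  · refine ⟨h.1, h.2.trans ?_⟩
    have h3 : √(4 - 1 : ℝ) = √3 := by norm_num
    have hsq_three : √(3 : ℝ) ^ 2 = 3 := sq_sqrt (by norm_num)
    have h36 : √(3 : ℝ) ^ 6 = 27 := by rw [show 6 = 2 * 3 from rfl, pow_mul, hsq_three]; norm_num
    simp only [h3, sqrt_one, sqrt_zero]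
    field_simp
    simp only [hsq_three, h36]
    norm_num
  · have hr := hasDerivAt_sqrt_div_sqrt_four_sub hs
    refine (((((hr.const_mul 2).fun_add ((hr.fun_pow 3).const_mul 2)).fun_add
      ((hr.fun_pow 5).const_mul (6 / 5))).fun_add ((hr.fun_pow 7).const_mul (2 / 7))).div_const
        256).congr_deriv ?_
    have hp : 0 < √s := sqrt_pos.2 hs.1
    have hq : 0 < √(4 - s) := sqrt_pos.2 (by linarith [hs.2])
    have hpq : √s ^ 2 = 4 - √(4 - s) ^ 2 := by
      rw [sq_sqrt hs.1.le, sq_sqrt (by linarith [hs.2])]; ring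
    have hp4 : √s ^ 4 = (4 - √(4 - s) ^ 2) ^ 2 := by rw [← hpq]; ring
    have hp6 : √s ^ 6 = (4 - √(4 - s) ^ 2) ^ 3 := by rw [← hpq]; ring
    push_cast
    field_simp
    rw [hp6, hp4, hpq]
    ring

lemma heatG_one_mul_heatG (t : ℝ) (y : EuclideanSpace ℝ (Fin 3)) :
    heatG 3 1 y * heatG 3 t y = (4 * π) ^ (-(3 : ℝ) / 2) * (4 * π * t) ^ (-(3 : ℝ) / 2) *
      rexp (-(1 / 4 + 1 / (4 * t)) * ‖y‖ ^ 2) := by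
  have : -(1 / 4 + 1 / (4 * t)) * ‖y‖ ^ 2 = -‖y‖ ^ 2 / (4 * 1) + -‖y‖ ^ 2 / (4 * t) := by ring
  rw [this, exp_add, heatG, heatG, mul_one]
  push_cast
  ring

section Moment

variable {j : Fin 3} {c : Fin 3 → ℕ} {P : EuclideanSpace ℝ (Fin 3) → ℝ}

lemma mul_heatG_mul_lap_pd_heatG (hP : ∀ y, P y * y j = ∏ i, y i ^ (2 * c i)) (t : ℝ)
    (y : EuclideanSpace ℝ (Fin 3)) :
    P y * heatG 3 1 y * lap (pd j (heatG 3 t)) y =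
      (4 * π) ^ (-(3 : ℝ) / 2) * (4 * π * t) ^ (-(3 : ℝ) / 2) *
      (5 / (4 * t ^ 2) * ((∏ i, y i ^ (2 * c i)) * rexp (-(1 / 4 + 1 / (4 * t)) * ‖y‖ ^ 2)) -
        1 / (8 * t ^ 3) *
          ((∏ i, y i ^ (2 * c i)) * ‖y‖ ^ 2 * rexp (-(1 / 4 + 1 / (4 * t)) * ‖y‖ ^ 2))) := by
  rw [lap_pd_heatG, ← hP]
  linear_combination (P y * y j * (5 / (4 * t ^ 2) - ‖y‖ ^ 2 / (8 * t ^ 3))) *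
    heatG_one_mul_heatG t y

lemma integral_mul_heatG_mul_lap_pd_heatG (hP : ∀ y, P y * y j = ∏ i, y i ^ (2 * c i)) {t : ℝ}
    (ht : 0 < t) :
    ∫ y, P y * heatG 3 1 y * lap (pd j (heatG 3 t)) y =
      (∏ i, ((2 * c i - 1).doubleFactorial : ℝ)) / √(4 * π) ^ 3 / √(1 + t) ^ 3 *
        (2 * t / (1 + t)) ^ (∑ i, c i) *
        (5 / (4 * t ^ 2) - (2 * (∑ i, c i : ℕ) + 3) / (4 * t ^ 2 * (1 + t))) := by
  have hb : 0 < 1 / 4 + 1 / (4 * t) := by positivity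
  have hb2 : 2 * (1 / 4 + 1 / (4 * t)) = (2 * t / (1 + t))⁻¹ := by field_simp; ring
  have hA (x : ℝ) (hx : 0 < x) : x ^ (-(3 : ℝ) / 2) = (√x ^ 3)⁻¹ := by
    rw [sqrt_eq_rpow, ← rpow_natCast, ← rpow_mul hx.le, ← rpow_neg hx.le]
    norm_num
  have hsqrt : √(π / (1 / 4 + 1 / (4 * t))) = √(4 * π * t) / √(1 + t) := by
    rw [← sqrt_div (by positivity)]
    congr 1
    field_simp
    ring
  have hπt : 0 < √(4 * π * t) := sqrt_pos.2 (by positivity)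
  simp only [mul_heatG_mul_lap_pd_heatG hP]
  rw [integral_const_mul, integral_sub
      ((integrable_prod_pow_mul_exp_neg_mul_norm_sq hb c).const_mul _)
      ((integrable_prod_pow_mul_norm_sq_mul_exp hb c).const_mul _),
    integral_const_mul, integral_const_mul, integral_prod_pow_mul_exp_neg_mul_norm_sq hb,
    integral_prod_pow_mul_norm_sq_mul_exp hb, hsqrt, hb2, hA _ (by positivity),
    hA _ (by positivity), inv_pow, div_inv_eq_mul, div_inv_eq_mul]
  generalize (2 * t / (1 + t)) ^ (∑ i, c i) = z
  push_cast
  field_simp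
  ring

lemma integrable_mul_heatG_mul_lap_pd_heatG (hP : ∀ y, P y * y j = ∏ i, y i ^ (2 * c i)) :
    Integrable (Function.uncurry fun (y : EuclideanSpace ℝ (Fin 3)) (s : ℝ) =>
      P y * heatG 3 1 y * lap (pd j (heatG 3 (1 - s / 2))) y * s ^ (-(1 : ℝ) / 2))
      (volume.prod (volume.restrict (Set.Ioo 0 1))) := by
  have hs : Integrable (fun s : ℝ => s ^ (-(1 : ℝ) / 2)) (volume.restrict (Set.Ioo 0 1)) := by
    have := (intervalIntegrable_iff_integrableOn_Ioo_of_le zero_le_one).1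
      (intervalIntegral.intervalIntegrable_rpow' (a := 0) (b := 1) (r := -(1 : ℝ) / 2)
        (by norm_num))
    exact this
  have hW : Integrable fun y : EuclideanSpace ℝ (Fin 3) =>
      (4 * π) ^ (-(3 : ℝ) / 2) *
        (5 * ((∏ i, y i ^ (2 * c i)) * rexp (-(1 / 2) * ‖y‖ ^ 2)) +
          1 * ((∏ i, y i ^ (2 * c i)) * ‖y‖ ^ 2 * rexp (-(1 / 2) * ‖y‖ ^ 2))) :=
    (((integrable_prod_pow_mul_exp_neg_mul_norm_sq one_half_pos c).const_mul 5).add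
      ((integrable_prod_pow_mul_norm_sq_mul_exp one_half_pos c).const_mul 1)).const_mul _
  have hmem : ∀ᵐ z : EuclideanSpace ℝ (Fin 3) × ℝ ∂(volume.prod (volume.restrict (Set.Ioo 0 1))),
      z.2 ∈ Set.Ioo (0 : ℝ) 1 :=
    Measure.quasiMeasurePreserving_snd.ae (ae_restrict_mem measurableSet_Ioo)
  refine (hW.mul_prod hs).mono' ?_ ?_
  · simp only [mul_heatG_mul_lap_pd_heatG hP, Function.uncurry_def]
    refine Measurable.aestronglyMeasurable ?_
    fun_prop
  · filter_upwards [hmem] with z hz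
    obtain ⟨y, s⟩ := z
    obtain ⟨h0, h1⟩ := hz
    simp only at h0 h1
    simp only [mul_heatG_mul_lap_pd_heatG hP, Function.uncurry_apply_pair, norm_mul]
    have ht : 1 / 2 ≤ 1 - s / 2 := by linarith
    have ht1 : 1 - s / 2 ≤ 1 := by linarith
    set t := 1 - s / 2
    have ht0 : 0 < t := by linarith
    have hWn : 0 ≤ ∏ i, y i ^ (2 * c i) :=
      Finset.prod_nonneg fun i _ => by rw [pow_mul]; positivity
    have hexp : rexp (-(1 / 4 + 1 / (4 * t)) * ‖y‖ ^ 2) ≤ rexp (-(1 / 2) * ‖y‖ ^ 2) := by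
      have : 1 / 4 ≤ 1 / (4 * t) := one_div_le_one_div_of_le (by linarith) (by linarith)
      gcongr
      linarith
    have hA : (4 * π * t) ^ (-(3 : ℝ) / 2) ≤ 1 := by
      refine rpow_le_one_of_one_le_of_nonpos ?_ (by norm_num)
      nlinarith [pi_gt_three]
    have h5 : 5 / (4 * t ^ 2) ≤ 5 := by
      rw [div_le_iff₀ (by positivity)]
      nlinarith
    have h8 : 1 / (8 * t ^ 3) ≤ 1 := by
      rw [div_le_iff₀ (by positivity)]
      have : (1 / 2) ^ 3 ≤ t ^ 3 := by gcongr
      linarith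
    have hs0 : 0 ≤ s ^ (-(1 : ℝ) / 2) := rpow_nonneg h0.le _
    have hA0 : 0 ≤ (4 * π * t) ^ (-(3 : ℝ) / 2) := by positivity
    have hB0 : 0 ≤ (4 * π) ^ (-(3 : ℝ) / 2) := by positivity
    rw [norm_of_nonneg hs0, norm_of_nonneg hA0, norm_of_nonneg hB0]
    refine mul_le_mul_of_nonneg_right ?_ hs0
    refine mul_le_mul (mul_le_of_le_one_right hB0 hA) ((norm_sub_le _ _).trans ?_)
      (norm_nonneg _) hB0
    rw [norm_of_nonneg (by positivity), norm_of_nonneg (by positivity)]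
    gcongr

lemma integral_mul_heatG_mul_integral_lap_pd_heatG
    (hP : ∀ y, P y * y j = ∏ i, y i ^ (2 * c i)) :
    ∫ y, P y * heatG 3 1 y *
        ∫ s in Set.Ioo (0 : ℝ) 1, s ^ (-(1 : ℝ) / 2) * lap (pd j (heatG 3 (1 - s / 2))) y =
      ∫ s in Set.Ioo (0 : ℝ) 1,
        (∏ i, ((2 * c i - 1).doubleFactorial : ℝ)) / √(4 * π) ^ 3 / √(1 + (1 - s / 2)) ^ 3 *
        (2 * (1 - s / 2) / (1 + (1 - s / 2))) ^ (∑ i, c i) *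
        (5 / (4 * (1 - s / 2) ^ 2) - (2 * (∑ i, c i : ℕ) + 3) /
          (4 * (1 - s / 2) ^ 2 * (1 + (1 - s / 2)))) / √s := by
  have h1 (y : EuclideanSpace ℝ (Fin 3)) : P y * heatG 3 1 y *
        ∫ s in Set.Ioo (0 : ℝ) 1, s ^ (-(1 : ℝ) / 2) * lap (pd j (heatG 3 (1 - s / 2))) y =
      ∫ s in Set.Ioo (0 : ℝ) 1,
        P y * heatG 3 1 y * lap (pd j (heatG 3 (1 - s / 2))) y * s ^ (-(1 : ℝ) / 2) := by
    rw [← integral_const_mul]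
    congr 1 with s
    ring
  simp only [h1]
  rw [integral_integral_swap (integrable_mul_heatG_mul_lap_pd_heatG hP)]
  refine setIntegral_congr_fun measurableSet_Ioo fun s hs => ?_
  have ht : 0 < 1 - s / 2 := by linarith [hs.2]
  have hsq : s ^ (-(1 : ℝ) / 2) = (√s)⁻¹ := by
    rw [sqrt_eq_rpow, ← rpow_neg hs.1.le]
    norm_num
  rw [integral_mul_const, integral_mul_heatG_mul_lap_pd_heatG hP ht, hsq, ← div_eq_mul_inv]

lemma sqrt_one_add_one_sub_half (s : ℝ) : √(1 + (1 - s / 2)) = √(4 - s) / √2 := by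
  rw [← sqrt_div' _ zero_le_two]
  congr 1
  ring

lemma sqrt_two_pow_three_div_sqrt_four_mul_pi_pow_three :
    √2 ^ 3 / √(4 * π) ^ 3 = √3 * √(6 * π) / (12 * π ^ 2) := by
  have hπ : √π ^ 4 = π ^ 2 := by rw [show 4 = 2 * 2 from rfl, pow_mul, sq_sqrt pi_pos.le]
  have h2 : √(2 : ℝ) ^ 2 = 2 := sq_sqrt (by norm_num)
  have h3 : √(3 : ℝ) ^ 2 = 3 := sq_sqrt (by norm_num)
  have h4 : √(4 : ℝ) = 2 := by rw [show (4 : ℝ) = 2 ^ 2 by norm_num, sqrt_sq two_pos.le]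
  have h6 : √(6 : ℝ) = √2 * √3 := by rw [← sqrt_mul two_pos.le]; norm_num
  have hp : 0 < √π := sqrt_pos.2 pi_pos
  rw [sqrt_mul (by norm_num), sqrt_mul (by norm_num), h4, h6]
  field_simp
  rw [h2, h3, hπ]
  ring

lemma integral_moment_of_sum_eq_one (hP : ∀ y, P y * y j = ∏ i, y i ^ (2 * c i))
    (hc : ∑ i, c i = 1) :
    ∫ y, P y * heatG 3 1 y *
        ∫ s in Set.Ioo (0 : ℝ) 1, s ^ (-(1 : ℝ) / 2) * lap (pd j (heatG 3 (1 - s / 2))) y =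
      (∏ i, ((2 * c i - 1).doubleFactorial : ℝ)) *
        (7 * √(6 * π) / (2 ^ 3 * 3 ^ 3 * π ^ 2)) := by
  have hcongr : ∀ s ∈ Set.Ioo (0 : ℝ) 1,
      (∏ i, ((2 * c i - 1).doubleFactorial : ℝ)) / √(4 * π) ^ 3 / √(1 + (1 - s / 2)) ^ 3 *
        (2 * (1 - s / 2) / (1 + (1 - s / 2))) ^ (∑ i, c i) *
        (5 / (4 * (1 - s / 2) ^ 2) - (2 * (∑ i, c i : ℕ) + 3) /
          (4 * (1 - s / 2) ^ 2 * (1 + (1 - s / 2)))) / √s =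
      ((∏ i, ((2 * c i - 1).doubleFactorial : ℝ)) / √(4 * π) ^ 3 * √2 ^ 3 * 10) *
        (1 / (√s * √(4 - s) ^ 7)) := by
    intro s hs
    have hp : 0 < √s := sqrt_pos.2 hs.1
    have hq : 0 < √(4 - s) := sqrt_pos.2 (by linarith [hs.2])
    have hq2 : 1 - s / 2 = √(4 - s) ^ 2 / 2 - 1 := by
      rw [sq_sqrt (by linarith [hs.2])]; ring
    have hq3 : 0 < √(4 - s) ^ 2 - 2 := by
      rw [sq_sqrt (by linarith [hs.2])]; linarith [hs.2]
    rw [sqrt_one_add_one_sub_half, hc, hq2]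
    generalize √(4 - s) = q at *
    have h1 : 1 + (q ^ 2 / 2 - 1) = q ^ 2 / 2 := by ring
    have h2 : q ^ 2 / 2 - 1 = (q ^ 2 - 2) / 2 := by ring
    rw [h1, h2]
    push_cast
    field_simp
    ring
  rw [integral_mul_heatG_mul_integral_lap_pd_heatG hP,
    setIntegral_congr_fun measurableSet_Ioo hcongr, integral_const_mul,
    integral_inv_sqrt_mul_sqrt_four_sub_pow_seven.2]
  have h3 : √(3 : ℝ) ≠ 0 := by positivity
  rw [div_mul_eq_mul_div, mul_div_assoc, sqrt_two_pow_three_div_sqrt_four_mul_pi_pow_three]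
  field_simp
  norm_num

lemma integral_moment_of_sum_eq_two (hP : ∀ y, P y * y j = ∏ i, y i ^ (2 * c i))
    (hc : ∑ i, c i = 2) :
    ∫ y, P y * heatG 3 1 y *
        ∫ s in Set.Ioo (0 : ℝ) 1, s ^ (-(1 : ℝ) / 2) * lap (pd j (heatG 3 (1 - s / 2))) y =
      (∏ i, ((2 * c i - 1).doubleFactorial : ℝ)) *
        (11 * √(6 * π) / (2 * 3 ^ 4 * 5 * π ^ 2)) := by
  have hcongr : ∀ s ∈ Set.Ioo (0 : ℝ) 1,
      (∏ i, ((2 * c i - 1).doubleFactorial : ℝ)) / √(4 * π) ^ 3 / √(1 + (1 - s / 2)) ^ 3 *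
        (2 * (1 - s / 2) / (1 + (1 - s / 2))) ^ (∑ i, c i) *
        (5 / (4 * (1 - s / 2) ^ 2) - (2 * (∑ i, c i : ℕ) + 3) /
          (4 * (1 - s / 2) ^ 2 * (1 + (1 - s / 2)))) / √s =
      ((∏ i, ((2 * c i - 1).doubleFactorial : ℝ)) / √(4 * π) ^ 3 * √2 ^ 3) *
        (20 * (1 / (√s * √(4 - s) ^ 7)) - 56 * (1 / (√s * √(4 - s) ^ 9))) := by
    intro s hs
    have hp : 0 < √s := sqrt_pos.2 hs.1
    have hq : 0 < √(4 - s) := sqrt_pos.2 (by linarith [hs.2])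
    have hq2 : 1 - s / 2 = √(4 - s) ^ 2 / 2 - 1 := by
      rw [sq_sqrt (by linarith [hs.2])]; ring
    have hq3 : 0 < √(4 - s) ^ 2 - 2 := by
      rw [sq_sqrt (by linarith [hs.2])]; linarith [hs.2]
    rw [sqrt_one_add_one_sub_half, hc, hq2]
    generalize √(4 - s) = q at *
    have h1 : 1 + (q ^ 2 / 2 - 1) = q ^ 2 / 2 := by ring
    have h2 : q ^ 2 / 2 - 1 = (q ^ 2 - 2) / 2 := by ring
    rw [h1, h2]
    push_cast
    field_simp
    ring
  rw [integral_mul_heatG_mul_integral_lap_pd_heatG hP,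
    setIntegral_congr_fun measurableSet_Ioo hcongr, integral_const_mul,
    integral_sub (integral_inv_sqrt_mul_sqrt_four_sub_pow_seven.1.const_mul 20)
      (integral_inv_sqrt_mul_sqrt_four_sub_pow_nine.1.const_mul 56),
    integral_const_mul, integral_const_mul, integral_inv_sqrt_mul_sqrt_four_sub_pow_seven.2,
    integral_inv_sqrt_mul_sqrt_four_sub_pow_nine.2]
  have h3 : √(3 : ℝ) ≠ 0 := by positivity
  rw [div_mul_eq_mul_div, mul_div_assoc, sqrt_two_pow_three_div_sqrt_four_mul_pi_pow_three]
  field_simp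
  norm_num

end Moment

/-- explicit Gaussian moment integrals for
`G(1,y) ∫₀¹ s^{−1/2} Δ∂_j G(1 − s/2, y) ds`. -/
theorem gaussian_moment_integrals_time :
    ∀ j : Fin 3,
      ((∫ y : EuclideanSpace ℝ (Fin 3), y j * heatG 3 1 y *
          ∫ s in Set.Ioo (0 : ℝ) 1, s ^ (-(1 : ℝ) / 2) * lap (pd j (heatG 3 (1 - s / 2))) y) =
        7 * Real.sqrt (6 * π) / (2 ^ 3 * 3 ^ 3 * π ^ 2)) ∧
      (∀ k : Fin 3, k ≠ j →
        (∫ y : EuclideanSpace ℝ (Fin 3), (y k) ^ 2 * y j * heatG 3 1 y *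
            ∫ s in Set.Ioo (0 : ℝ) 1, s ^ (-(1 : ℝ) / 2) * lap (pd j (heatG 3 (1 - s / 2))) y) =
          11 * Real.sqrt (6 * π) / (2 * 3 ^ 4 * 5 * π ^ 2)) ∧
      ((∫ y : EuclideanSpace ℝ (Fin 3), (y j) ^ 3 * heatG 3 1 y *
          ∫ s in Set.Ioo (0 : ℝ) 1, s ^ (-(1 : ℝ) / 2) * lap (pd j (heatG 3 (1 - s / 2))) y) =
        11 * Real.sqrt (6 * π) / (2 * 3 ^ 3 * 5 * π ^ 2)) := by

  intro j
  refine ⟨?_, fun k hkj => ?_, ?_⟩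
  · rw [integral_moment_of_sum_eq_one (P := fun y => y j) (c := Pi.single j 1)]
    · rw [Finset.prod_eq_single j] <;> simp +contextual
    · intro y
      rw [Finset.prod_eq_single j] <;> simp +contextual [sq]
    · simp
  · rw [integral_moment_of_sum_eq_two (P := fun y => y k ^ 2 * y j)
      (c := Pi.single j 1 + Pi.single k 1)]
    · rw [Finset.prod_eq_one, one_mul]
      intro i _
      by_cases hi : i = j
      · subst hi
        simp [hkj.symm]
      · by_cases hik : i = k <;> simp [hi, hik, hkj]
    · intro y
      simp only [Pi.add_apply, mul_add, pow_add, Finset.prod_mul_distrib]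
      rw [Finset.prod_eq_single j, Finset.prod_eq_single k] <;> simp +contextual
      ring
    · simp [Finset.sum_add_distrib]
  · rw [integral_moment_of_sum_eq_two (P := fun y => y j ^ 3) (c := Pi.single j 2)]
    · rw [Finset.prod_eq_single j] <;> simp +contextual [Nat.doubleFactorial]
      ring
    · intro y
      rw [Finset.prod_eq_single j] <;> simp +contextual
      ring
    · simp
end
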